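/- Let n ≥ 1, let f_1, …, f_n : ℝ^d → ℝ be differentiable convex functions whose gradients are L-Lipschitz (L > 0), let f = (1/n)∑_{i=1}^n f_i, assume f is μ-strongly convex for some μ > 0 (f(x) − f(y) − ⟨∇f(y), x − y⟩ ≥ (μ/2)‖x − y‖² for all x, y), and let x* be the minimizer of f. Let x, w ∈ ℝ^d, let θ ∈ (0, 1), p ∈ (0, 1], and let η > 0 satisfy η ≤ 1/( L·θ·(1 + 1/(1 − θ)) ). Define u = θx + (1 − θ)w, and for each i ∈ {1,…,n} define g_i = ∇f_i(u) − ∇f_i(w) + ∇f(w), x⁺_i = (1/(1 + μη))·(x + μη·u) − (η/(1 + μη))·g_i, and b_i = θ·x⁺_i + (1 − θ)·w. Then (1/n)∑_{i=1}^n [ p·f(b_i) + (1 − p)·f(w) ] − f(x*) + ((1 + μη)pθ/(2η))·(1/n)∑_{i=1}^n ‖x⁺_i − x*‖² ≤ (1 − pθ)·( f(w) − f(x*) ) + (pθ/(2η))·‖x − x*‖². -/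

import Mathlib

open scoped RealInnerProductSpace

section Smooth

variable {E : Type*} [NormedAddCommGroup E] [InnerProductSpace ℝ E] [CompleteSpace E]

theorem Differentiable.hasDerivAt_comp_lineSegment {f : E → ℝ} (hf : Differentiable ℝ f)
    (x v : E) (t : ℝ) :
    HasDerivAt (fun s : ℝ => f (x + s • v)) ⟪gradient f (x + t • v), v⟫ t := by
  have hline : HasDerivAt (fun s : ℝ => x + s • v) v t := by
    simpa using ((hasDerivAt_id t).smul_const v).const_add x
  have h := (hf (x + t • v)).hasFDerivAt.comp_hasDerivAt t hline
  rwa [← inner_gradient_left] at h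

/-- The first-order condition for a differentiable convex function. -/
theorem ConvexOn.add_inner_gradient_le {f : E → ℝ} (hc : ConvexOn ℝ Set.univ f)
    (hf : Differentiable ℝ f) (x y : E) :
    f x + ⟪gradient f x, y - x⟫ ≤ f y := by
  have hconv : ConvexOn ℝ Set.univ (fun t : ℝ => f (x + t • (y - x))) := by
    have h := hc.comp_affineMap (AffineMap.lineMap (k := ℝ) x y)
    refine h.congr fun t _ => ?_
    simp [AffineMap.lineMap_apply, add_comm]
  have hs := hconv.le_slope_of_hasDerivAt (Set.mem_univ 0) (Set.mem_univ 1) one_pos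
    (hf.hasDerivAt_comp_lineSegment x (y - x) 0)
  simp [slope_def_field, -inner_gradient_left] at hs
  linarith

/-- The quadratic upper bound for a function with Lipschitz gradient. -/
theorem Differentiable.le_add_inner_gradient_add_sq {f : E → ℝ} {L : ℝ}
    (hf : Differentiable ℝ f)
    (hlip : ∀ x y, ‖gradient f x - gradient f y‖ ≤ L * ‖x - y‖) (x y : E) :
    f y ≤ f x + ⟪gradient f x, y - x⟫ + L / 2 * ‖y - x‖ ^ 2 := by
  set v := y - x with hv
  have hderiv (t : ℝ) : HasDerivAt
      (fun s : ℝ => f (x + s • v) - s * ⟪gradient f x, v⟫ - L / 2 * ‖v‖ ^ 2 * s ^ 2)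
      (⟪gradient f (x + t • v), v⟫ - ⟪gradient f x, v⟫ - L * ‖v‖ ^ 2 * t) t := by
    have h := ((hf.hasDerivAt_comp_lineSegment x v t).sub
      ((hasDerivAt_id t).mul_const ⟪gradient f x, v⟫)).sub
      (((hasDerivAt_id t).pow 2).const_mul (L / 2 * ‖v‖ ^ 2))
    refine h.congr_deriv ?_
    simp [-inner_gradient_left]
    ring
  have hanti := antitoneOn_of_hasDerivWithinAt_nonpos (convex_Icc (0 : ℝ) 1)
    (fun t _ => (hderiv t).continuousAt.continuousWithinAt)
    (fun t _ => (hderiv t).hasDerivWithinAt) (fun t ht => by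
      rw [interior_Icc] at ht
      have h1 := real_inner_le_norm (gradient f (x + t • v) - gradient f x) v
      have h2 := mul_le_mul_of_nonneg_right (hlip (x + t • v) x) (norm_nonneg v)
      rw [inner_sub_left] at h1
      rw [add_sub_cancel_left, norm_smul, Real.norm_of_nonneg ht.1.le] at h2
      nlinarith)
  have h := hanti (Set.left_mem_Icc.2 zero_le_one) (Set.right_mem_Icc.2 zero_le_one) zero_le_one
  simp [hv, -inner_gradient_left] at h
  linarith

/-- For a convex function with `L`-Lipschitz gradient, the difference of gradients is controlled
by the Bregman divergence. -/
theorem ConvexOn.norm_gradient_sub_sq_le {f : E → ℝ} {L : ℝ} (hc : ConvexOn ℝ Set.univ f)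
    (hf : Differentiable ℝ f) (hL : 0 < L)
    (hlip : ∀ x y, ‖gradient f x - gradient f y‖ ≤ L * ‖x - y‖) (u w : E) :
    ‖gradient f u - gradient f w‖ ^ 2 ≤ 2 * L * (f w - f u - ⟪gradient f u, w - u⟫) := by
  set a := gradient f u - gradient f w with ha
  have h1 := hc.add_inner_gradient_le hf u (w + L⁻¹ • a)
  have h2 := hf.le_add_inner_gradient_add_sq hlip w (w + L⁻¹ • a)
  have h3 : ⟪gradient f u, a⟫ - ⟪gradient f w, a⟫ = ‖a‖ ^ 2 := by
    rw [← inner_sub_left, real_inner_self_eq_norm_sq]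
  rw [add_sub_cancel_left, norm_smul, inner_smul_right, mul_pow, norm_inv,
    Real.norm_of_nonneg hL.le] at h2
  rw [add_sub_right_comm, inner_add_right, inner_smul_right] at h1
  have h4 : L⁻¹ * ‖a‖ ^ 2 - L / 2 * (L⁻¹ ^ 2 * ‖a‖ ^ 2) ≤ f w - f u - ⟪gradient f u, w - u⟫ := by
    rw [← h3] at h2 ⊢
    linarith
  have h5 : L⁻¹ * ‖a‖ ^ 2 - L / 2 * (L⁻¹ ^ 2 * ‖a‖ ^ 2) = ‖a‖ ^ 2 / (2 * L) := by
    field_simp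
    ring
  rw [h5, div_le_iff₀ (by positivity)] at h4
  linarith

end Smooth

section Prox

variable {E : Type*} [NormedAddCommGroup E] [InnerProductSpace ℝ E]

/-- The three-point identity for the proximal step
`z = argmin ⟪g, z⟫ + ‖z - x‖ ^ 2 / (2 * η) + μ / 2 * ‖z - u‖ ^ 2`. -/
theorem inner_add_norm_sq_eq_of_prox_step {μ η : ℝ} (hμ : 0 < μ) (hη : 0 < η) {x u g z : E}
    (hz : z = (1 / (1 + μ * η)) • (x + (μ * η) • u) - (η / (1 + μ * η)) • g) (y : E) :
    ⟪g, z - x⟫ + 1 / (2 * η) * ‖z - x‖ ^ 2 + μ / 2 * ‖z - u‖ ^ 2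
        + (1 + μ * η) / (2 * η) * ‖z - y‖ ^ 2 =
      ⟪g, y - x⟫ + 1 / (2 * η) * ‖x - y‖ ^ 2 + μ / 2 * ‖y - u‖ ^ 2 := by
  have hpos : 0 < 1 + μ * η := by positivity
  have hg : g = η⁻¹ • (-(z - x) - (μ * η) • (z - u)) := by
    rw [hz]
    match_scalars <;> field_simp <;> ring
  obtain ⟨a, rfl⟩ : ∃ a, z = y + a := ⟨z - y, by abel⟩
  obtain ⟨b, rfl⟩ : ∃ b, x = y + b := ⟨x - y, by abel⟩
  obtain ⟨c, rfl⟩ : ∃ c, u = y + c := ⟨u - y, by abel⟩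
  rw [hg]
  simp only [add_sub_add_left_eq_sub, add_sub_cancel_left, sub_add_cancel_left,
    ← real_inner_self_eq_norm_sq, inner_sub_left, inner_sub_right, inner_smul_left, inner_neg_left,
    inner_neg_right, real_inner_comm a b, real_inner_comm a c, real_inner_comm b c,
    RCLike.conj_to_real]
  field_simp
  ring

/-- Young's inequality for the inner product. -/
theorem real_inner_le_norm_sq_add_norm_sq {c : ℝ} (hc : 0 < c) (a b : E) :
    ⟪a, b⟫ ≤ c / 2 * ‖a‖ ^ 2 + 1 / (2 * c) * ‖b‖ ^ 2 := by
  have h := real_inner_le_norm a b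
  have h2 : c / 2 * ‖a‖ ^ 2 + 1 / (2 * c) * ‖b‖ ^ 2 - ‖a‖ * ‖b‖
      = (c * ‖a‖ - ‖b‖) ^ 2 / (2 * c) := by
    field_simp
    ring
  have h3 : 0 ≤ (c * ‖a‖ - ‖b‖) ^ 2 / (2 * c) := by positivity
  linarith

end Prox

/-- Lemma 8 of the paper (one iteration of ANITA in the strongly convex case,
`α = 1 + μη`). -/
theorem anita_strongly_convex_one_step {d n : ℕ} (hn : 1 ≤ n)
    (f : Fin n → EuclideanSpace ℝ (Fin d) → ℝ) (L : ℝ) (hL : 0 < L)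
    (hdiff : ∀ i, Differentiable ℝ (f i))
    (hconv : ∀ i, ConvexOn ℝ Set.univ (f i))
    (hlip : ∀ i x y, ‖gradient (f i) x - gradient (f i) y‖ ≤ L * ‖x - y‖)
    (F : EuclideanSpace ℝ (Fin d) → ℝ)
    (hF : F = fun x => (1 / (n : ℝ)) * ∑ i, f i x)
    (μ : ℝ) (hμ : 0 < μ)
    (hsc : ∀ x y, F x - F y - ⟪gradient F y, x - y⟫ ≥ (μ / 2) * ‖x - y‖ ^ 2)
    (xstar : EuclideanSpace ℝ (Fin d)) (hmin : ∀ y, F xstar ≤ F y)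
    (x w : EuclideanSpace ℝ (Fin d)) (θ p η : ℝ)
    (hθ : θ ∈ Set.Ioo (0 : ℝ) 1) (hp : p ∈ Set.Ioc (0 : ℝ) 1) (hη : 0 < η)
    (hηle : η ≤ 1 / (L * θ * (1 + 1 / (1 - θ))))
    (u : EuclideanSpace ℝ (Fin d)) (hu : u = θ • x + (1 - θ) • w)
    (g xp b : Fin n → EuclideanSpace ℝ (Fin d))
    (hg : ∀ i, g i = gradient (f i) u - gradient (f i) w + gradient F w)
    (hxp : ∀ i, xp i = (1 / (1 + μ * η)) • (x + (μ * η) • u) - (η / (1 + μ * η)) • g i)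
    (hb : ∀ i, b i = θ • xp i + (1 - θ) • w) :
    (1 / (n : ℝ)) * ∑ i, (p * F (b i) + (1 - p) * F w) - F xstar
        + ((1 + μ * η) * p * θ / (2 * η)) * ((1 / (n : ℝ)) * ∑ i, ‖xp i - xstar‖ ^ 2) ≤
      (1 - p * θ) * (F w - F xstar) + (p * θ / (2 * η)) * ‖x - xstar‖ ^ 2 := by
  obtain ⟨hθ0, hθ1⟩ := hθ
  have hp0 := hp.1
  have hn0 : (n : ℝ) ≠ 0 := by positivity
  have hθ' : 0 < 1 - θ := by linarith
  have havg (z : EuclideanSpace ℝ (Fin d)) : (1 / (n : ℝ)) * ∑ i, f i z = F z := by rw [hF]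
  have hgradF (z : EuclideanSpace ℝ (Fin d)) :
      gradient F z = (1 / (n : ℝ)) • ∑ i, gradient (f i) z := by
    apply HasGradientAt.gradient
    rw [hasGradientAt_iff_hasFDerivAt, hF, map_smul, map_sum]
    have h := (HasFDerivAt.fun_sum (u := Finset.univ) fun i _ =>
      ((hdiff i) z).hasGradientAt.hasFDerivAt).const_smul (1 / (n : ℝ))
    exact h
  have hinner (z v : EuclideanSpace ℝ (Fin d)) :
      (1 / (n : ℝ)) * ∑ i, ⟪gradient (f i) z, v⟫ = ⟪gradient F z, v⟫ := by
    rw [hgradF, real_inner_smul_left, sum_inner]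
  have hconst (c : ℝ) : (1 / (n : ℝ)) * ∑ _i : Fin n, c = c := by
    simp [hn0]
  have hmono {a c : Fin n → ℝ} (h : ∀ i, a i ≤ c i) :
      (1 / (n : ℝ)) * ∑ i, a i ≤ (1 / (n : ℝ)) * ∑ i, c i :=
    mul_le_mul_of_nonneg_left (Finset.sum_le_sum fun i _ => h i) (by positivity)
  have hdescent (z : EuclideanSpace ℝ (Fin d)) :
      F z ≤ F u + ⟪gradient F u, z - u⟫ + L / 2 * ‖z - u‖ ^ 2 := by
    have h := hmono fun i => (hdiff i).le_add_inner_gradient_add_sq (hlip i) u z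
    simpa only [Finset.sum_add_distrib, mul_add, havg, hinner, hconst] using h
  have hstep : L * θ * (1 + 1 / (1 - θ)) ≤ 1 / η := by
    rwa [le_div_comm₀ (by positivity) hη]
  set D := gradient F u - gradient F w with hD
  have hbound (i : Fin n) :
      F (b i) + θ * ((1 + μ * η) / (2 * η)) * ‖xp i - xstar‖ ^ 2 ≤
        F u + (1 - θ) / (2 * L) *
            (‖D‖ ^ 2 - 2 * (⟪gradient (f i) u, D⟫ - ⟪gradient (f i) w, D⟫))
          + (1 - θ) * (f i w - f i u - ⟪gradient (f i) u, w - u⟫)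
          + θ * (⟪gradient (f i) u, xstar - x⟫ - ⟪gradient (f i) w, xstar - x⟫
            + ⟪gradient F w, xstar - x⟫)
          + θ * (1 / (2 * η) * ‖x - xstar‖ ^ 2 + μ / 2 * ‖xstar - u‖ ^ 2) := by
    have hbu : b i - u = θ • (xp i - x) := by
      rw [hb, hu]
      module
    have h1 := hdescent (b i)
    rw [hbu, norm_smul, Real.norm_of_nonneg hθ0.le, inner_smul_right] at h1
    have h2 := inner_add_norm_sq_eq_of_prox_step hμ hη (hxp i) xstar
    have h3 := real_inner_le_norm_sq_add_norm_sq (c := (1 - θ) / (L * θ)) (by positivity)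
      (gradient F u - g i) (xp i - x)
    have h4 := (hconv i).norm_gradient_sub_sq_le (hdiff i) hL (hlip i) u w
    have hDg : gradient F u - g i = D - (gradient (f i) u - gradient (f i) w) := by
      rw [hg, hD]
      abel
    have h5 : ‖gradient F u - g i‖ ^ 2 =
        ‖D‖ ^ 2 - 2 * (⟪gradient (f i) u, D⟫ - ⟪gradient (f i) w, D⟫)
          + ‖gradient (f i) u - gradient (f i) w‖ ^ 2 := by
      rw [hDg, norm_sub_sq_real, real_inner_comm, inner_sub_left]
    have h6 : ⟪g i, xstar - x⟫ = ⟪gradient (f i) u, xstar - x⟫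
        - ⟪gradient (f i) w, xstar - x⟫ + ⟪gradient F w, xstar - x⟫ := by
      rw [hg, inner_add_left, inner_sub_left]
    rw [← h6]
    rw [inner_sub_left] at h3
    have h7 := mul_le_mul_of_nonneg_left h3 hθ0.le
    have h8 := mul_le_mul_of_nonneg_left h4 (show 0 ≤ (1 - θ) / (2 * L) by positivity)
    have h9 := mul_le_mul_of_nonneg_right hstep
      (show 0 ≤ θ / 2 * ‖xp i - x‖ ^ 2 by positivity)
    have h10 : 0 ≤ θ * (μ / 2 * ‖xp i - u‖ ^ 2) := by positivity
    have e1 : θ * ((1 - θ) / (L * θ) / 2 * ‖gradient F u - g i‖ ^ 2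
        + 1 / (2 * ((1 - θ) / (L * θ))) * ‖xp i - x‖ ^ 2) =
        (1 - θ) / (2 * L) * ‖gradient F u - g i‖ ^ 2
          + L * θ ^ 2 / (2 * (1 - θ)) * ‖xp i - x‖ ^ 2 := by
      field_simp
    have e2 : (1 - θ) / (2 * L) * (2 * L * (f i w - f i u - ⟪gradient (f i) u, w - u⟫)) =
        (1 - θ) * (f i w - f i u - ⟪gradient (f i) u, w - u⟫) := by
      field_simp
    have e3 : L * θ * (1 + 1 / (1 - θ)) * (θ / 2 * ‖xp i - x‖ ^ 2) =
        L / 2 * (θ * ‖xp i - x‖) ^ 2 + L * θ ^ 2 / (2 * (1 - θ)) * ‖xp i - x‖ ^ 2 := by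
      field_simp
    have e4 : 1 / η * (θ / 2 * ‖xp i - x‖ ^ 2) = θ * (1 / (2 * η) * ‖xp i - x‖ ^ 2) := by
      field_simp
    rw [e1, h5] at h7
    rw [e2] at h8
    rw [e3, e4] at h9
    have h2' := congrArg (θ * ·) h2
    simp only [mul_add] at h2' h7 ⊢
    linarith
  have hmean := hmono hbound
  simp only [Finset.sum_add_distrib, Finset.sum_sub_distrib, ← Finset.mul_sum, mul_add, mul_sub,
    mul_left_comm (1 / (n : ℝ)), havg, hinner, hconst] at hmean
  have hvar : ⟪gradient F u, D⟫ - ⟪gradient F w, D⟫ = ‖D‖ ^ 2 := by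
    rw [← inner_sub_left, real_inner_self_eq_norm_sq]
  have hvar' : 0 ≤ (1 - θ) / (2 * L) * ‖D‖ ^ 2 := by positivity
  have hcombo : θ * ⟪gradient F u, xstar - x⟫ - (1 - θ) * ⟪gradient F u, w - u⟫ =
      θ * ⟪gradient F u, xstar - u⟫ := by
    simp only [← real_inner_smul_right, ← inner_sub_right]
    congr 1
    rw [hu]
    module
  have hstrong := mul_le_mul_of_nonneg_left (hsc xstar u) hθ0.le
  have hvar_mul := congrArg (fun r => (1 - θ) / (2 * L) * (2 * r)) hvar
  have hscaled : (1 / (n : ℝ)) * ∑ i, F (b i)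
        + θ * ((1 + μ * η) / (2 * η)) * ((1 / (n : ℝ)) * ∑ i, ‖xp i - xstar‖ ^ 2) ≤
      (1 - θ) * F w + θ * F xstar + θ * (1 / (2 * η) * ‖x - xstar‖ ^ 2) := by
    simp only [mul_sub] at hvar_mul hstrong
    linarith
  have hfinal := mul_le_mul_of_nonneg_left hscaled hp0.le
  rw [Finset.sum_add_distrib, mul_add, hconst, ← Finset.mul_sum, mul_left_comm]
  have e1 : (1 + μ * η) * p * θ / (2 * η) = p * (θ * ((1 + μ * η) / (2 * η))) := by ring
  have e2 : p * θ / (2 * η) * ‖x - xstar‖ ^ 2 =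
      p * (θ * (1 / (2 * η) * ‖x - xstar‖ ^ 2)) := by ring
  rw [e1, e2]
  linarith
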